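/- Let σ ≥ 1 and u₀ ∈ H¹(𝕋). There exist T > 0 and K > 0, independent of ε, such that for every ε > 0 the solution u_ε of the mollified gDNLS equation with initial data u₀ exists on [0,T] and satisfies sup_{t∈[0,T]} ‖u_ε(t)‖_{H¹} ≤ K. -/

import Mathlib

open MeasureTheory Filter

noncomputable section

/-- `k`-th Fourier coefficient of a `2π`-periodic function `f : ℝ → ℂ`. -/
def fc (f : ℝ → ℂ) (k : ℤ) : ℂ :=
  (1 / (2 * Real.pi)) *
    ∫ x in (0:ℝ)..(2 * Real.pi), f x * Complex.exp (-(Complex.I) * (k : ℂ) * (x : ℂ))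

/-- Square of the `Hˢ` norm, `‖f‖_{Hˢ}² = Σₖ (1+|k|^{2s}) |f̂(k)|²`. -/
def HsNormSq (s : ℝ) (f : ℝ → ℂ) : ℝ :=
  ∑' k : ℤ, (1 + |(k : ℝ)| ^ (2 * s)) * ‖fc f k‖ ^ 2

/-- The `Hˢ` norm. -/
def HsNorm (s : ℝ) (f : ℝ → ℂ) : ℝ := Real.sqrt (HsNormSq s f)

/-- Membership in `Hˢ(𝕋)`: `2π`-periodic, locally integrable, with finite `Hˢ` norm. -/
def MemHs (s : ℝ) (f : ℝ → ℂ) : Prop :=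
  Function.Periodic f (2 * Real.pi) ∧
  IntervalIntegrable f MeasureTheory.volume 0 (2 * Real.pi) ∧
  Summable (fun k : ℤ => (1 + |(k : ℝ)| ^ (2 * s)) * ‖fc f k‖ ^ 2)

/-- The `Hˢ` inner product `⟨f,g⟩_{Hˢ} = Σₖ (1+|k|^{2s}) f̂(k) conj (ĝ(k))`. -/
def HsInner (s : ℝ) (f g : ℝ → ℂ) : ℂ :=
  ∑' k : ℤ, (Complex.ofReal (1 + |(k : ℝ)| ^ (2 * s))) * fc f k * (starRingEnd ℂ) (fc g k)

/-- Frequency cutoff `⌈1/ε⌉` of the mollifier. -/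
def Nmoll (ε : ℝ) : ℤ := ⌈1 / ε⌉

/-- The mollifier `J_ε`: Fourier projection onto modes `|k| ≤ ⌈1/ε⌉`. -/
def Jmol (ε : ℝ) (f : ℝ → ℂ) : ℝ → ℂ :=
  fun x => ∑ k ∈ Finset.Icc (-(Nmoll ε)) (Nmoll ε),
    fc f k * Complex.exp (Complex.I * (k : ℂ) * (x : ℂ))

/-- The Schrödinger semigroup `e^{it∂ₓ²}`, acting by `f̂(k) ↦ e^{-ik²t} f̂(k)`. -/
def Sg (t : ℝ) (f : ℝ → ℂ) : ℝ → ℂ :=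
  fun x => ∑' k : ℤ,
    Complex.exp (-(Complex.I) * (k : ℂ) ^ 2 * (t : ℂ)) * fc f k *
      Complex.exp (Complex.I * (k : ℂ) * (x : ℂ))

/-- The truncated semigroup `e^{i J_ε ∂ₓ² t}`: multiplier `e^{-ik²t}` for `|k| ≤ ⌈1/ε⌉`, `1` otherwise. -/
def Bmol (ε t : ℝ) (f : ℝ → ℂ) : ℝ → ℂ :=
  fun x => f x - Jmol ε f x
    + ∑ k ∈ Finset.Icc (-(Nmoll ε)) (Nmoll ε),
        Complex.exp (-(Complex.I) * (k : ℂ) ^ 2 * (t : ℂ)) * fc f k *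
          Complex.exp (Complex.I * (k : ℂ) * (x : ℂ))

/-- The gDNLS nonlinearity `|f|^{2σ} f_x`. -/
def NL (σ : ℝ) (f : ℝ → ℂ) : ℝ → ℂ :=
  fun x => (Complex.ofReal (‖f x‖ ^ (2 * σ))) * deriv f x

/-- `u` is a mild solution of gDNLS on `[0,T]` with initial data `u₀`. -/
def IsMildSolution (σ T : ℝ) (u₀ : ℝ → ℂ) (u : ℝ → ℝ → ℂ) : Prop :=
  ∀ t ∈ Set.Icc (0 : ℝ) T, ∀ x : ℝ,
    u t x = Sg t u₀ x - ∫ s in (0:ℝ)..t, Sg (t - s) (NL σ (u s)) x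

/-- `u ∈ L^∞(0,T;Hˢ)`. -/
def BddHs (s T : ℝ) (u : ℝ → ℝ → ℂ) : Prop :=
  (∀ t ∈ Set.Icc (0 : ℝ) T, MemHs s (u t)) ∧
  ∃ M : ℝ, ∀ t ∈ Set.Icc (0 : ℝ) T, HsNorm s (u t) ≤ M

/-- Continuity in time with values in `Hˢ`, on a time set `I`. -/
def ContHsOn (s : ℝ) (I : Set ℝ) (u : ℝ → ℝ → ℂ) : Prop :=
  (∀ t ∈ I, MemHs s (u t)) ∧
  ∀ t ∈ I, Filter.Tendsto (fun t' => HsNorm s (fun x => u t' x - u t x))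
    (nhdsWithin t I) (nhds 0)

/-- `u ∈ C([0,T];Hˢ)`. -/
def ContHs (s T : ℝ) (u : ℝ → ℝ → ℂ) : Prop := ContHsOn s (Set.Icc 0 T) u

/-- The mollified nonlinearity `|J_ε f|^{2σ} J_ε f_x`. -/
def MolNL (σ ε : ℝ) (f : ℝ → ℂ) : ℝ → ℂ :=
  fun x => (Complex.ofReal (‖Jmol ε f x‖ ^ (2 * σ))) * deriv (Jmol ε f) x

/-- `F_ε(f) = -|J_ε f|^{2σ} J_ε f_x + i ∂ₓ²(J_ε f)`. -/
def Fmol (σ ε : ℝ) (f : ℝ → ℂ) : ℝ → ℂ :=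
  fun x => -(MolNL σ ε f x) + Complex.I * deriv (deriv (Jmol ε f)) x

/-- The right-hand side `J_ε F_ε(f)` of the mollified gDNLS equation. -/
def MolRHS (σ ε : ℝ) (f : ℝ → ℂ) : ℝ → ℂ := Jmol ε (Fmol σ ε f)

/-- `u` solves the mollified gDNLS equation `∂ₜ u = J_ε F_ε(u)` on the time set `I`. -/
def SolvesMollified (σ ε : ℝ) (I : Set ℝ) (u : ℝ → ℝ → ℂ) : Prop :=
  ∀ t ∈ I, ∀ x : ℝ, HasDerivAt (fun τ => u τ x) (MolRHS σ ε (u t) x) t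

/-- Square of the `L²(𝕋)` norm. -/
def L2NormSq (f : ℝ → ℂ) : ℝ := ∫ x in (0:ℝ)..(2 * Real.pi), ‖f x‖ ^ 2

/-- The `L²(𝕋)` norm. -/
def L2Norm (f : ℝ → ℂ) : ℝ := Real.sqrt (L2NormSq f)

/-- Square of the `L²(0,T;Hˢ)` norm. -/
def L2HsNormSq (T s : ℝ) (u : ℝ → ℝ → ℂ) : ℝ := ∫ t in (0:ℝ)..T, HsNormSq s (u t)

/-- The `L²(0,T;Hˢ)` norm. -/
def L2HsNorm (T s : ℝ) (u : ℝ → ℝ → ℂ) : ℝ := Real.sqrt (L2HsNormSq T s u)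

/-- Membership in `L²(0,T;Hˢ)`. -/
def MemL2Hs (T s : ℝ) (u : ℝ → ℝ → ℂ) : Prop :=
  (∀ t ∈ Set.Ioc (0:ℝ) T, MemHs s (u t)) ∧
  IntervalIntegrable (fun t => HsNormSq s (u t)) MeasureTheory.volume 0 T

/-- The gDNLS Hamiltonian `H[f] = ∫ |f_x|² + (σ+1)⁻² conj f^{σ+1} D_x (f^{σ+1})`, `D_x = -i∂ₓ`. -/
def Ham (σ : ℝ) (f : ℝ → ℂ) : ℂ :=
  ∫ x in (0:ℝ)..(2 * Real.pi),
    Complex.ofReal (‖deriv f x‖ ^ 2)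
      + Complex.ofReal (((σ + 1) ^ 2)⁻¹) * ((starRingEnd ℂ) (f x)) ^ ((σ : ℂ) + 1)
        * (-(Complex.I) * deriv (fun y => (f y) ^ ((σ : ℂ) + 1)) x)

/-- The mollified Hamiltonian `H_ε[f]`. -/
def Hmol (σ ε : ℝ) (f : ℝ → ℂ) : ℂ :=
  ∫ x in (0:ℝ)..(2 * Real.pi),
    Complex.ofReal (‖deriv f x‖ ^ 2)
      + Complex.ofReal (((σ + 1) ^ 2)⁻¹) * ((starRingEnd ℂ) (Jmol ε f x)) ^ ((σ : ℂ) + 1)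
        * (-(Complex.I) * deriv (fun y => (Jmol ε f y) ^ ((σ : ℂ) + 1)) x)

/-- The mass `M[f] = ∫ |f|²`. -/
def Mass (f : ℝ → ℂ) : ℝ := ∫ x in (0:ℝ)..(2 * Real.pi), ‖f x‖ ^ 2

/-- The momentum `P[f] = -(1/2) ∫ conj f · D_x f`, `D_x = -i∂ₓ`. -/
def Mom (f : ℝ → ℂ) : ℂ :=
  -(1/2 : ℂ) * ∫ x in (0:ℝ)..(2 * Real.pi), (starRingEnd ℂ) (f x) * (-(Complex.I) * deriv f x)

section

open Set Metric
open scoped Topology NNReal ComplexConjugate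

/-- The trigonometric polynomial with frequencies in `s` and coefficients `a`. -/
def trigPoly (s : Finset ℤ) (a : ℤ → ℂ) (x : ℝ) : ℂ :=
  ∑ k ∈ s, a k * Complex.exp (Complex.I * (k : ℂ) * (x : ℂ))

/-- The Fourier multiplier of `∂ₓ`. -/
def dCoeff (a : ℤ → ℂ) (k : ℤ) : ℂ := Complex.I * (k : ℂ) * a k

/-- The nonlinearity `|v|^{2σ} vₓ` for `v = trigPoly s a`. -/
def trigNL (σ : ℝ) (s : Finset ℤ) (a : ℤ → ℂ) (x : ℝ) : ℂ :=
  ((‖trigPoly s a x‖ ^ (2 * σ) : ℝ) : ℂ) * trigPoly s (dCoeff a) x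

/-- The mollified gDNLS vector field, acting on Fourier coefficients. -/
def coeffField (σ : ℝ) (s : Finset ℤ) (a : ℤ → ℂ) (k : ℤ) : ℂ :=
  -fc (trigNL σ s a) k - Complex.I * (k : ℂ) ^ 2 * a k

lemma continuous_trigPoly (s : Finset ℤ) (a : ℤ → ℂ) : Continuous (trigPoly s a) := by
  unfold trigPoly; fun_prop

lemma hasDerivAt_trigPoly (s : Finset ℤ) (a : ℤ → ℂ) (x : ℝ) :
    HasDerivAt (trigPoly s a) (trigPoly s (dCoeff a) x) x := by
  unfold trigPoly
  refine HasDerivAt.fun_sum fun k _ => ?_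
  have h1 : HasDerivAt (fun y : ℝ => Complex.I * (k : ℂ) * (y : ℂ)) (Complex.I * (k : ℂ)) x := by
    simpa using (Complex.ofRealCLM.hasDerivAt (x := x)).const_mul (Complex.I * (k : ℂ))
  have h2 := (h1.cexp).const_mul (a k)
  exact h2.congr_deriv (by simp only [dCoeff]; ring)

lemma deriv_trigPoly (s : Finset ℤ) (a : ℤ → ℂ) :
    deriv (trigPoly s a) = trigPoly s (dCoeff a) :=
  funext fun x => (hasDerivAt_trigPoly s a x).deriv

lemma periodic_exp_int_mul (k : ℤ) (x : ℝ) :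
    Complex.exp (Complex.I * (k : ℂ) * ((x + 2 * Real.pi : ℝ) : ℂ)) =
      Complex.exp (Complex.I * (k : ℂ) * (x : ℂ)) := by
  have : Complex.I * (k : ℂ) * ((x + 2 * Real.pi : ℝ) : ℂ) =
      Complex.I * (k : ℂ) * (x : ℂ) + k * (2 * Real.pi * Complex.I) := by
    push_cast; ring
  rw [this, Complex.exp_add, Complex.exp_int_mul_two_pi_mul_I, mul_one]

lemma periodic_trigPoly (s : Finset ℤ) (a : ℤ → ℂ) :
    Function.Periodic (trigPoly s a) (2 * Real.pi) := by
  intro x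
  simp only [trigPoly, periodic_exp_int_mul]

lemma continuous_trigNL {σ : ℝ} (hσ : 1 ≤ σ) (s : Finset ℤ) (a : ℤ → ℂ) :
    Continuous (trigNL σ s a) := by
  unfold trigNL
  refine Continuous.mul ?_ (continuous_trigPoly _ _)
  exact Complex.continuous_ofReal.comp
    ((continuous_trigPoly s a).norm.rpow_const fun x => Or.inr (by linarith))

lemma norm_trigPoly_le (s : Finset ℤ) (a : ℤ → ℂ) (x : ℝ) :
    ‖trigPoly s a x‖ ≤ ∑ k ∈ s, ‖a k‖ := by
  refine (norm_sum_le _ _).trans_eq (Finset.sum_congr rfl fun k _ => ?_)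
  have : Complex.I * (k : ℂ) * (x : ℂ) = ((k * x : ℝ) : ℂ) * Complex.I := by push_cast; ring
  rw [norm_mul, this, Complex.norm_exp_ofReal_mul_I, mul_one]

lemma intervalIntegrable_mul_exp {f : ℝ → ℂ}
    (hf : IntervalIntegrable f volume 0 (2 * Real.pi)) (k : ℤ) :
    IntervalIntegrable (fun x : ℝ => f x * Complex.exp (-(Complex.I) * (k : ℂ) * (x : ℂ)))
      volume 0 (2 * Real.pi) :=
  hf.mul_continuousOn (by fun_prop)

lemma fc_add {f g : ℝ → ℂ} (hf : IntervalIntegrable f volume 0 (2 * Real.pi))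
    (hg : IntervalIntegrable g volume 0 (2 * Real.pi)) (k : ℤ) :
    fc (fun x => f x + g x) k = fc f k + fc g k := by
  simp only [fc, add_mul]
  rw [intervalIntegral.integral_add (intervalIntegrable_mul_exp hf k)
    (intervalIntegrable_mul_exp hg k), mul_add]

lemma fc_const_mul (c : ℂ) (f : ℝ → ℂ) (k : ℤ) :
    fc (fun x => c * f x) k = c * fc f k := by
  simp only [fc, mul_assoc c, intervalIntegral.integral_const_mul]
  ring

lemma fc_neg (f : ℝ → ℂ) (k : ℤ) : fc (fun x => -f x) k = -fc f k := by
  simpa using fc_const_mul (-1) f k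

lemma two_pi_mul_fc (f : ℝ → ℂ) (k : ℤ) :
    2 * Real.pi * fc f k =
      ∫ x in (0:ℝ)..(2 * Real.pi), f x * Complex.exp (-(Complex.I) * (k : ℂ) * (x : ℂ)) := by
  have : (Real.pi : ℂ) ≠ 0 := by exact_mod_cast Real.pi_ne_zero
  rw [fc, ← mul_assoc]
  field_simp

lemma integral_exp_int_mul (k : ℤ) :
    ∫ x in (0:ℝ)..(2 * Real.pi), Complex.exp (Complex.I * (k : ℂ) * (x : ℂ)) =
      if k = 0 then (2 * Real.pi : ℂ) else 0 := by
  split_ifs with h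
  · simp [h]
  · have h0 : Complex.I * (k : ℂ) ≠ 0 := mul_ne_zero Complex.I_ne_zero (by exact_mod_cast h)
    rw [integral_exp_mul_complex h0]
    have := periodic_exp_int_mul k 0
    simp only [zero_add] at this
    rw [this]; simp

lemma fc_trigPoly (s : Finset ℤ) (a : ℤ → ℂ) (k : ℤ) :
    fc (trigPoly s a) k = if k ∈ s then a k else 0 := by
  have hpi : (Real.pi : ℂ) ≠ 0 := by exact_mod_cast Real.pi_ne_zero
  have h : ∀ x : ℝ, trigPoly s a x * Complex.exp (-(Complex.I) * (k : ℂ) * (x : ℂ)) =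
      ∑ j ∈ s, a j * Complex.exp (Complex.I * ((j - k : ℤ) : ℂ) * (x : ℂ)) := by
    intro x
    rw [trigPoly, Finset.sum_mul]
    refine Finset.sum_congr rfl fun j _ => ?_
    rw [mul_assoc, ← Complex.exp_add]
    congr 2; push_cast; ring
  simp only [fc, h]
  rw [intervalIntegral.integral_finsetSum fun j _ =>
    (Continuous.intervalIntegrable (by fun_prop) _ _)]
  simp only [intervalIntegral.integral_const_mul, integral_exp_int_mul, sub_eq_zero]
  simp only [mul_ite, mul_zero, Finset.sum_ite_eq']
  split_ifs
  · field_simp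
  · rfl

/-- The pairing of a trigonometric polynomial with a function, in terms of coefficients. -/
lemma integral_conj_trigPoly_mul (s : Finset ℤ) (b : ℤ → ℂ) {f : ℝ → ℂ} (hf : Continuous f) :
    ∫ x in (0:ℝ)..(2 * Real.pi), conj (trigPoly s b x) * f x =
      2 * Real.pi * ∑ k ∈ s, conj (b k) * fc f k := by
  have h : ∀ x : ℝ, conj (trigPoly s b x) * f x =
      ∑ k ∈ s, conj (b k) * (f x * Complex.exp (-(Complex.I) * (k : ℂ) * (x : ℂ))) := by
    intro x
    rw [trigPoly, map_sum, Finset.sum_mul]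
    refine Finset.sum_congr rfl fun j _ => ?_
    rw [map_mul, ← Complex.exp_conj]
    simp only [map_mul, Complex.conj_I, Complex.conj_ofReal, map_intCast]
    ring
  simp only [h]
  rw [intervalIntegral.integral_finsetSum fun j _ =>
    (Continuous.intervalIntegrable (by fun_prop) _ _), Finset.mul_sum]
  refine Finset.sum_congr rfl fun k _ => ?_
  rw [intervalIntegral.integral_const_mul, ← two_pi_mul_fc]
  ring

lemma integral_norm_sq_trigPoly (s : Finset ℤ) (a : ℤ → ℂ) :
    ∫ x in (0:ℝ)..(2 * Real.pi), ‖trigPoly s a x‖ ^ 2 = 2 * Real.pi * ∑ k ∈ s, ‖a k‖ ^ 2 := by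
  have h := integral_conj_trigPoly_mul s a (continuous_trigPoly s a)
  simp only [Complex.conj_mul'] at h
  have h2 : ∑ k ∈ s, conj (a k) * fc (trigPoly s a) k = ∑ k ∈ s, ((‖a k‖ ^ 2 : ℝ) : ℂ) := by
    refine Finset.sum_congr rfl fun k hk => ?_
    rw [fc_trigPoly, if_pos hk, Complex.conj_mul']; push_cast; rfl
  rw [h2] at h
  have h3 : ((∫ x in (0:ℝ)..(2 * Real.pi), ‖trigPoly s a x‖ ^ 2 : ℝ) : ℂ) =
      ((2 * Real.pi * ∑ k ∈ s, ‖a k‖ ^ 2 : ℝ) : ℂ) := by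
    rw [← intervalIntegral.integral_ofReal]; push_cast; push_cast at h; exact h
  exact_mod_cast h3

lemma norm_fc_le {g : ℝ → ℝ} {F : ℝ → ℂ} (hF : ∀ x, ‖F x‖ ≤ g x) (hg : Continuous g) (k : ℤ) :
    ‖fc F k‖ ≤ (2 * Real.pi)⁻¹ * ∫ x in (0:ℝ)..(2 * Real.pi), g x := by
  have hpi := Real.pi_pos
  rw [fc, norm_mul]
  have : ‖(1 / (2 * Real.pi) : ℂ)‖ = (2 * Real.pi)⁻¹ := by
    rw [one_div, norm_inv, norm_mul, Complex.norm_real, Real.norm_of_nonneg hpi.le]; simp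
  rw [this]
  refine mul_le_mul_of_nonneg_left ?_ (by positivity)
  refine intervalIntegral.norm_integral_le_of_norm_le (by positivity) ?_
    (hg.intervalIntegrable _ _)
  refine Eventually.of_forall fun x _ => ?_
  have : -(Complex.I) * (k : ℂ) * (x : ℂ) = ((-(k * x) : ℝ) : ℂ) * Complex.I := by push_cast; ring
  rw [norm_mul, this, Complex.norm_exp_ofReal_mul_I, mul_one]
  exact hF x

lemma sum_norm_le_sqrt (s : Finset ℤ) (a : ℤ → ℂ) (w : ℤ → ℝ) (hw : ∀ k, 0 < w k) :
    ∑ k ∈ s, ‖a k‖ ≤ √(∑ k ∈ s, (w k)⁻¹) * √(∑ k ∈ s, w k * ‖a k‖ ^ 2) := by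
  rw [← Real.sqrt_mul (Finset.sum_nonneg fun k _ => (inv_pos.2 (hw k)).le)]
  refine Real.le_sqrt_of_sq_le ?_
  refine Finset.sum_sq_le_sum_mul_sum_of_sq_le_mul s (fun k _ => (inv_pos.2 (hw k)).le)
    (fun k _ => mul_nonneg (hw k).le (sq_nonneg _)) fun k _ => ?_
  rw [inv_mul_cancel_left₀ (hw k).ne']

lemma HasDerivAt.norm_rpow_complex {f : ℝ → ℂ} {f' : ℂ} {t p : ℝ} (hf : HasDerivAt f f' t)
    (hp : 1 < p) :
    HasDerivAt (fun τ => ‖f τ‖ ^ p) (p * ‖f t‖ ^ (p - 2) * (conj (f t) * f').re) t := by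
  have h := (hasFDerivAt_norm_rpow (f t) hp).comp_hasDerivAt t hf
  refine h.congr_deriv ?_
  simp [Complex.inner, mul_comm]

lemma HasDerivAt.im_conj_mul {v w : ℝ → ℂ} {v' w' : ℂ} {t : ℝ} (hv : HasDerivAt v v' t)
    (hw : HasDerivAt w w' t) :
    HasDerivAt (fun τ => (conj (v τ) * w τ).im)
      ((conj v' * w t).im + (conj (v t) * w').im) t := by
  have hc : HasDerivAt (fun τ => conj (v τ)) (conj v') t :=
    Complex.conjCLE.toContinuousLinearMap.hasFDerivAt.comp_hasDerivAt t hv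
  have h := Complex.imCLM.hasFDerivAt.comp_hasDerivAt t (hc.mul hw)
  exact h.congr_deriv (by simp)

lemma HasDerivAt.trigPoly {s : Finset ℤ} {a : ℝ → ℤ → ℂ} {b : ℤ → ℂ} {t : ℝ}
    (h : ∀ k ∈ s, HasDerivAt (fun τ => a τ k) (b k) t) (x : ℝ) :
    HasDerivAt (fun τ => _root_.trigPoly s (a τ) x) (_root_.trigPoly s b x) t :=
  HasDerivAt.fun_sum fun k hk => (h k hk).mul_const _

lemma ContinuousOn.trigPoly {s : Finset ℤ} {a : ℝ → ℤ → ℂ} {U : Set ℝ}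
    (h : ∀ k ∈ s, ContinuousOn (fun τ => a τ k) U) :
    ContinuousOn (fun p : ℝ × ℝ => _root_.trigPoly s (a p.1) p.2) (U ×ˢ univ) := by
  unfold _root_.trigPoly
  refine continuousOn_finsetSum _ fun k hk => ?_
  refine ContinuousOn.mul ?_ (by fun_prop)
  exact (h k hk).comp continuousOn_fst fun p hp => hp.1

lemma integral_deriv_eq_zero_of_periodic {f f' : ℝ → ℝ} {c : ℝ} (hf : Function.Periodic f c)
    (h : ∀ x, HasDerivAt f (f' x) x) (hc : Continuous f') : ∫ x in (0:ℝ)..c, f' x = 0 := by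
  rw [intervalIntegral.integral_eq_sub_of_hasDerivAt (fun x _ => h x) (hc.intervalIntegrable _ _)]
  simpa using sub_eq_zero.2 (hf 0)

/-- Differentiation under the integral sign for jointly continuous derivatives. -/
lemma hasDerivAt_intervalIntegral_of_continuousOn {F F' : ℝ → ℝ → ℝ} {U : Set ℝ} (hU : IsOpen U)
    {c d : ℝ} (hF : ∀ t ∈ U, Continuous (F t))
    (hd : ∀ t ∈ U, ∀ x, HasDerivAt (fun τ => F τ x) (F' t x) t)
    (hF' : ContinuousOn (fun p : ℝ × ℝ => F' p.1 p.2) (U ×ˢ univ)) {t : ℝ} (ht : t ∈ U) :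
    HasDerivAt (fun τ => ∫ x in c..d, F τ x) (∫ x in c..d, F' t x) t := by
  obtain ⟨δ, hδ, hball⟩ := Metric.nhds_basis_closedBall.mem_iff.1 (hU.mem_nhds ht)
  have hcpt : IsCompact (closedBall t δ ×ˢ uIcc c d) :=
    (isCompact_closedBall t δ).prod isCompact_uIcc
  obtain ⟨C, hC⟩ := hcpt.exists_bound_of_continuousOn
    (hF'.mono (prod_mono hball (subset_univ _)))
  have hcont : Continuous (F' t) := by
    have h1 : ContinuousOn (fun x : ℝ => F' t x) univ :=
      hF'.comp (f := fun x : ℝ => (t, x)) (by fun_prop) fun x _ => ⟨ht, mem_univ _⟩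
    exact continuousOn_univ.1 h1
  refine (intervalIntegral.hasDerivAt_integral_of_dominated_loc_of_deriv_le
    (bound := fun _ => C) (closedBall_mem_nhds t hδ) ?_ ?_ ?_ ?_ ?_ ?_).2
  · filter_upwards [hU.mem_nhds ht] with τ hτ using (hF τ hτ).aestronglyMeasurable
  · exact (hF t ht).intervalIntegrable _ _
  · exact hcont.aestronglyMeasurable
  · exact Eventually.of_forall fun x hx τ hτ => hC (τ, x) ⟨hτ, uIoc_subset_uIcc hx⟩
  · exact intervalIntegrable_const
  · exact Eventually.of_forall fun x _ τ hτ => hd τ (hball hτ) x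

/-- The potential part `∫ |v|^{2σ} Im (conj v vₓ)` of the Hamiltonian, `v = trigPoly s a`. -/
def trigPotential (σ : ℝ) (s : Finset ℤ) (a : ℤ → ℂ) : ℝ :=
  ∫ x in (0:ℝ)..(2 * Real.pi),
    ‖trigPoly s a x‖ ^ (2 * σ) * (conj (trigPoly s a x) * trigPoly s (dCoeff a) x).im

/-- The field is tangent to the `L²` spheres. -/
lemma re_sum_conj_mul_coeffField {σ : ℝ} (hσ : 1 ≤ σ) (s : Finset ℤ) (a : ℤ → ℂ) :
    (∑ k ∈ s, conj (a k) * coeffField σ s a k).re = 0 := by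
  have hpi := Real.pi_pos
  have h1 := integral_conj_trigPoly_mul s a (continuous_trigNL hσ s a)
  have hcont : Continuous fun x => ‖trigPoly s a x‖ ^ (2 * σ) *
      (conj (trigPoly s a x) * trigPoly s (dCoeff a) x).re := by
    have h0 := continuous_trigPoly s a
    have h2 := continuous_trigPoly s (dCoeff a)
    have h3 := h0.norm.rpow_const (p := 2 * σ) fun x => Or.inr (by linarith)
    fun_prop
  have h2 : ∫ x in (0:ℝ)..(2 * Real.pi), (2 * σ + 2) * (‖trigPoly s a x‖ ^ (2 * σ) *
      (conj (trigPoly s a x) * trigPoly s (dCoeff a) x).re) = 0 := by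
    refine integral_deriv_eq_zero_of_periodic (f := fun x => ‖trigPoly s a x‖ ^ (2 * σ + 2))
      (fun x => by simp only [periodic_trigPoly s a x]) (fun x => ?_) (hcont.const_mul _)
    have := (hasDerivAt_trigPoly s a x).norm_rpow_complex (p := 2 * σ + 2) (by linarith)
    refine this.congr_deriv ?_
    rw [add_sub_cancel_right, mul_assoc]
  rw [intervalIntegral.integral_const_mul] at h2
  have h3 : ∫ x in (0:ℝ)..(2 * Real.pi), ‖trigPoly s a x‖ ^ (2 * σ) *
      (conj (trigPoly s a x) * trigPoly s (dCoeff a) x).re = 0 :=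
    (mul_eq_zero.1 h2).resolve_left (by linarith)
  have h4 : (∫ x in (0:ℝ)..(2 * Real.pi), conj (trigPoly s a x) * trigNL σ s a x).re = 0 := by
    refine Eq.trans ?_ h3
    have := Complex.reCLM.intervalIntegral_comp_comm (μ := volume) (a := 0) (b := 2 * Real.pi)
      (f := fun x => conj (trigPoly s a x) * trigNL σ s a x)
      ((Continuous.mul (Complex.continuous_conj.comp (continuous_trigPoly s a))
        (continuous_trigNL hσ s a)).intervalIntegrable _ _)
    simp only [Complex.reCLM_apply] at this
    rw [← this]
    refine intervalIntegral.integral_congr fun x _ => ?_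
    simp only [trigNL]
    rw [mul_left_comm, Complex.re_ofReal_mul]
  have h5 : (∑ k ∈ s, conj (a k) * fc (trigNL σ s a) k).re = 0 := by
    rw [h1] at h4
    have : (2 * Real.pi : ℂ) = ((2 * Real.pi : ℝ) : ℂ) := by push_cast; rfl
    rw [this, Complex.re_ofReal_mul] at h4
    exact (mul_eq_zero.1 h4).resolve_left (by positivity)
  rw [Complex.re_sum] at h5 ⊢
  rw [← neg_eq_zero, ← Finset.sum_neg_distrib, ← h5]
  refine Finset.sum_congr rfl fun k _ => ?_
  have hk : ((k : ℂ) ^ 2) = (((k : ℝ) ^ 2 : ℝ) : ℂ) := by push_cast; rfl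
  have e : conj (a k) * coeffField σ s a k = -(conj (a k) * fc (trigNL σ s a) k) -
      Complex.I * (((k : ℝ) ^ 2 * ‖a k‖ ^ 2 : ℝ) : ℂ) := by
    have := Complex.conj_mul' (a k)
    rw [coeffField]; push_cast; rw [← this]; ring
  rw [e]; simp only [Complex.sub_re, Complex.neg_re, Complex.I_mul_re, Complex.ofReal_im]; ring

lemma im_conj_mul_conj_mul (v h w : ℂ) :
    (conj v * h).re * (conj v * w).im - (conj v * w).re * (conj v * h).im =
      ‖v‖ ^ 2 * (conj h * w).im := by
  rw [← Complex.normSq_eq_norm_sq, Complex.normSq_apply]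
  simp; ring

lemma hasDerivAt_trigPotential {σ : ℝ} (hσ : 1 ≤ σ) {s : Finset ℤ} {a b : ℝ → ℤ → ℂ} {U : Set ℝ}
    (hU : IsOpen U) (ha : ∀ t ∈ U, ∀ k ∈ s, HasDerivAt (fun τ => a τ k) (b t k) t)
    (hb : ∀ k ∈ s, ContinuousOn (fun τ => b τ k) U) {t : ℝ} (ht : t ∈ U) :
    HasDerivAt (fun τ => trigPotential σ s (a τ))
      ((2 * σ + 2) * (2 * Real.pi * (∑ k ∈ s, conj (b t k) * fc (trigNL σ s (a t)) k).im)) t := by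
  have hac : ∀ k ∈ s, ContinuousOn (fun τ => a τ k) U :=
    fun k hk τ hτ => (ha τ hτ k hk).continuousAt.continuousWithinAt
  have hd : ∀ t ∈ U, ∀ k ∈ s, HasDerivAt (fun τ => dCoeff (a τ) k) (dCoeff (b t) k) t :=
    fun t ht k hk => (ha t ht k hk).const_mul _
  have hpow : ∀ p : ℝ, 0 ≤ p →
      ContinuousOn (fun q : ℝ × ℝ => ‖trigPoly s (a q.1) q.2‖ ^ p) (U ×ˢ univ) :=
    fun p hp => (ContinuousOn.trigPoly hac).norm.rpow_const fun _ _ => Or.inr hp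
  have c1 := ContinuousOn.trigPoly hac
  have c2 := ContinuousOn.trigPoly hb
  have c3 : ContinuousOn (fun p : ℝ × ℝ => trigPoly s (dCoeff (a p.1)) p.2) (U ×ˢ univ) :=
    ContinuousOn.trigPoly (a := fun τ => dCoeff (a τ)) fun k hk => (hac k hk).const_mul _
  have c4 : ContinuousOn (fun p : ℝ × ℝ => trigPoly s (dCoeff (b p.1)) p.2) (U ×ˢ univ) :=
    ContinuousOn.trigPoly (a := fun τ => dCoeff (b τ)) fun k hk => (hb k hk).const_mul _
  have c5 := hpow (2 * σ - 2) (by linarith)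
  have c6 := hpow (2 * σ) (by linarith)
  have im_cont : ∀ f g : ℝ × ℝ → ℂ, ContinuousOn f (U ×ˢ univ) → ContinuousOn g (U ×ˢ univ) →
      ContinuousOn (fun p => (conj (f p) * g p).im) (U ×ˢ univ) := fun f g hf hg =>
    Complex.continuous_im.comp_continuousOn
      ((Complex.continuous_conj.comp_continuousOn hf).mul hg)
  have re_cont : ∀ f g : ℝ × ℝ → ℂ, ContinuousOn f (U ×ˢ univ) → ContinuousOn g (U ×ˢ univ) →
      ContinuousOn (fun p => (conj (f p) * g p).re) (U ×ˢ univ) := fun f g hf hg =>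
    Complex.continuous_re.comp_continuousOn
      ((Complex.continuous_conj.comp_continuousOn hf).mul hg)
  have key := hasDerivAt_intervalIntegral_of_continuousOn (c := 0) (d := 2 * Real.pi) hU
    (F := fun τ x => ‖trigPoly s (a τ) x‖ ^ (2 * σ) *
      (conj (trigPoly s (a τ) x) * trigPoly s (dCoeff (a τ)) x).im)
    (F' := fun τ x => (2 * σ * ‖trigPoly s (a τ) x‖ ^ (2 * σ - 2) *
        (conj (trigPoly s (a τ) x) * trigPoly s (b τ) x).re) *
        (conj (trigPoly s (a τ) x) * trigPoly s (dCoeff (a τ)) x).im +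
      ‖trigPoly s (a τ) x‖ ^ (2 * σ) *
        ((conj (trigPoly s (b τ) x) * trigPoly s (dCoeff (a τ)) x).im +
          (conj (trigPoly s (a τ) x) * trigPoly s (dCoeff (b τ)) x).im))
    (fun τ _ => ?_) (fun τ hτ x => ?_) ?_ ht
  · refine key.congr_deriv ?_
    set v := trigPoly s (a t) with hv
    set w := trigPoly s (dCoeff (a t)) with hw
    set h := trigPoly s (b t) with hh
    set h' := trigPoly s (dCoeff (b t)) with hh'
    have kv : Continuous v := continuous_trigPoly _ _
    have kw : Continuous w := continuous_trigPoly _ _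
    have kh : Continuous h := continuous_trigPoly _ _
    have kh' : Continuous h' := continuous_trigPoly _ _
    have kp1 := kv.norm.rpow_const (p := 2 * σ) fun x => Or.inr (by linarith)
    have kp2 := kv.norm.rpow_const (p := 2 * σ - 2) fun x => Or.inr (by linarith)
    have hz : ∫ x in (0:ℝ)..(2 * Real.pi), ((2 * σ * ‖v x‖ ^ (2 * σ - 2) *
        (conj (v x) * w x).re) * (conj (v x) * h x).im +
        ‖v x‖ ^ (2 * σ) * ((conj (w x) * h x).im + (conj (v x) * h' x).im)) = 0 := by
      refine integral_deriv_eq_zero_of_periodic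
        (f := fun x => ‖v x‖ ^ (2 * σ) * (conj (v x) * h x).im) (fun x => ?_) (fun x => ?_) ?_
      · simp only [hv, hh, periodic_trigPoly _ _ x]
      · exact ((hasDerivAt_trigPoly s (a t) x).norm_rpow_complex (by linarith)).mul
          ((hasDerivAt_trigPoly s (a t) x).im_conj_mul (hasDerivAt_trigPoly s (b t) x))
      · fun_prop
    refine (sub_zero _).symm.trans ((congrArg (HSub.hSub _) hz.symm).trans
      ((intervalIntegral.integral_sub ?_ ?_).symm.trans ?_))
    · exact Continuous.intervalIntegrable (by fun_prop) _ _
    · exact Continuous.intervalIntegrable (by fun_prop) _ _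
    have hp := integral_conj_trigPoly_mul s (b t) (continuous_trigNL hσ s (a t))
    have e1 : 2 * Real.pi * (∑ k ∈ s, conj (b t k) * fc (trigNL σ s (a t)) k).im =
        ∫ x in (0:ℝ)..(2 * Real.pi), (conj (h x) * trigNL σ s (a t) x).im := by
      have := Complex.imCLM.intervalIntegral_comp_comm (μ := volume) (a := 0) (b := 2 * Real.pi)
        (f := fun x => conj (h x) * trigNL σ s (a t) x)
        ((Continuous.mul (Complex.continuous_conj.comp kh)
          (continuous_trigNL hσ s (a t))).intervalIntegrable _ _)
      simp only [Complex.imCLM_apply] at this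
      rw [this, hp]
      have : (2 * Real.pi : ℂ) = ((2 * Real.pi : ℝ) : ℂ) := by push_cast; rfl
      rw [this, Complex.im_ofReal_mul]
    rw [e1, ← intervalIntegral.integral_const_mul]
    refine intervalIntegral.integral_congr fun x _ => ?_
    have e2 : (conj (h x) * trigNL σ s (a t) x).im =
        ‖v x‖ ^ (2 * σ) * (conj (h x) * w x).im := by
      rw [trigNL, mul_left_comm, Complex.im_ofReal_mul]
    have e3 : ‖v x‖ ^ (2 * σ - 2) * ‖v x‖ ^ 2 = ‖v x‖ ^ (2 * σ) := by
      rcases (norm_nonneg (v x)).eq_or_lt with h0 | h0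
      · rw [← h0, Real.zero_rpow (by linarith : 2 * σ ≠ 0)]; simp
      · rw [← Real.rpow_natCast, ← Real.rpow_add h0]; norm_num
    have e4 := im_conj_mul_conj_mul (v x) (h x) (w x)
    have e5 : (conj (w x) * h x).im = -(conj (h x) * w x).im := by
      simp; ring
    simp only [e2, e5]
    linear_combination (2 * σ * ‖v x‖ ^ (2 * σ - 2)) * e4 + 2 * σ * (conj (h x) * w x).im * e3
  · have k1 := continuous_trigPoly s (a τ)
    have k2 := continuous_trigPoly s (dCoeff (a τ))
    have k3 := k1.norm.rpow_const (p := 2 * σ) fun x => Or.inr (by linarith)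
    fun_prop
  · exact ((HasDerivAt.trigPoly (ha τ hτ) x).norm_rpow_complex (by linarith)).mul
      ((HasDerivAt.trigPoly (ha τ hτ) x).im_conj_mul
        (HasDerivAt.trigPoly (a := fun τ => dCoeff (a τ)) (hd τ hτ) x))
  · exact (((continuousOn_const.mul c5).mul (re_cont _ _ c1 c2)).mul (im_cont _ _ c1 c3)).add
      (c6.mul ((im_cont _ _ c2 c3).add (im_cont _ _ c1 c4)))

lemma hasDerivAt_norm_sq_complex {f : ℝ → ℂ} {f' : ℂ} {t : ℝ} (hf : HasDerivAt f f' t) :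
    HasDerivAt (fun τ => ‖f τ‖ ^ 2) (2 * (conj (f t) * f').re) t := by
  refine hf.norm_sq.congr_deriv ?_
  simp [Complex.inner, mul_comm]

lemma eq_of_hasDerivAt_zero {f : ℝ → ℝ} {T : ℝ} (h : ∀ t ∈ Icc 0 T, HasDerivAt f 0 t) :
    ∀ t ∈ Icc 0 T, f t = f 0 :=
  constant_of_has_deriv_right_zero (fun t ht => (h t ht).continuousAt.continuousWithinAt)
    fun t ht => (h t (Ico_subset_Icc_self ht)).hasDerivWithinAt

lemma hasDerivAt_mass {σ : ℝ} (hσ : 1 ≤ σ) {s : Finset ℤ} {a : ℝ → ℤ → ℂ} {r t : ℝ}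
    (ha : ∀ k ∈ s, HasDerivAt (fun τ => a τ k) (r * coeffField σ s (a t) k) t) :
    HasDerivAt (fun τ => ∑ k ∈ s, ‖a τ k‖ ^ 2) 0 t := by
  refine (HasDerivAt.fun_sum fun k hk => hasDerivAt_norm_sq_complex (ha k hk)).congr_deriv ?_
  have h := re_sum_conj_mul_coeffField hσ s (a t)
  rw [Complex.re_sum] at h
  have : ∀ k, 2 * (conj (a t k) * (r * coeffField σ s (a t) k)).re =
      2 * r * (conj (a t k) * coeffField σ s (a t) k).re := fun k => by
    rw [mul_left_comm, Complex.re_ofReal_mul]; ring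
  simp only [this, ← Finset.mul_sum, h, mul_zero]

/-- Conservation of the Hamiltonian along the mollified flow. -/
lemma hasDerivAt_energy {σ : ℝ} (hσ : 1 ≤ σ) {s : Finset ℤ} {a : ℝ → ℤ → ℂ} {U : Set ℝ}
    (hU : IsOpen U)
    (ha : ∀ t ∈ U, ∀ k ∈ s, HasDerivAt (fun τ => a τ k) (coeffField σ s (a t) k) t)
    (hb : ∀ k ∈ s, ContinuousOn (fun τ => coeffField σ s (a τ) k) U) {t : ℝ} (ht : t ∈ U) :
    HasDerivAt (fun τ => ∑ k ∈ s, (k : ℝ) ^ 2 * ‖a τ k‖ ^ 2 +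
      ((2 * σ + 2) * Real.pi)⁻¹ * trigPotential σ s (a τ)) 0 t := by
  have h1 := hasDerivAt_trigPotential hσ (b := fun τ k => coeffField σ s (a τ) k) hU ha hb ht
  have h2 : HasDerivAt (fun τ => ∑ k ∈ s, (k : ℝ) ^ 2 * ‖a τ k‖ ^ 2)
      (∑ k ∈ s, (k : ℝ) ^ 2 * (2 * (conj (a t k) * coeffField σ s (a t) k).re)) t :=
    HasDerivAt.fun_sum fun k hk => (hasDerivAt_norm_sq_complex (ha t ht k hk)).const_mul _
  refine (h2.add (h1.const_mul _)).congr_deriv ?_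
  have hpi := Real.pi_pos
  have hσ' : (2 * σ + 2) ≠ 0 := by linarith
  have e : ∀ k : ℤ, (k : ℝ) ^ 2 * (2 * (conj (a t k) * coeffField σ s (a t) k).re) =
      -(2 * (conj (coeffField σ s (a t) k) * fc (trigNL σ s (a t)) k).im) := fun k => by
    have hk : ((k : ℂ) ^ 2) = (((k : ℝ) ^ 2 : ℝ) : ℂ) := by push_cast; rfl
    simp only [coeffField, hk]
    generalize fc (trigNL σ s (a t)) k = w
    generalize ((k : ℝ) ^ 2) = q
    simp
    ring
  rw [Complex.im_sum, Finset.sum_congr rfl fun k _ => e k, Finset.sum_neg_distrib,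
    ← Finset.mul_sum]
  field_simp
  ring

lemma norm_dCoeff_sq (a : ℤ → ℂ) (k : ℤ) : ‖dCoeff a k‖ ^ 2 = (k : ℝ) ^ 2 * ‖a k‖ ^ 2 := by
  simp [dCoeff, mul_pow]

lemma integral_norm_sq_trigPoly_dCoeff (s : Finset ℤ) (a : ℤ → ℂ) :
    ∫ x in (0:ℝ)..(2 * Real.pi), ‖trigPoly s (dCoeff a) x‖ ^ 2 =
      2 * Real.pi * ∑ k ∈ s, (k : ℝ) ^ 2 * ‖a k‖ ^ 2 := by
  simp only [integral_norm_sq_trigPoly, norm_dCoeff_sq]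

lemma abs_trigPotential_le {σ : ℝ} (hσ : 1 ≤ σ) {s : Finset ℤ} {a : ℤ → ℂ} {V η : ℝ}
    (hV : ∑ k ∈ s, ‖a k‖ ≤ V) (hη : 0 < η) :
    |trigPotential σ s a| ≤ V ^ (2 * σ) * Real.pi *
      (η⁻¹ * ∑ k ∈ s, ‖a k‖ ^ 2 + η * ∑ k ∈ s, (k : ℝ) ^ 2 * ‖a k‖ ^ 2) := by
  have hpi := Real.pi_pos
  have k1 := continuous_trigPoly s a
  have k2 := continuous_trigPoly s (dCoeff a)
  have hV0 : 0 ≤ V := (Finset.sum_nonneg fun _ _ => norm_nonneg _).trans hV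
  have h : ‖trigPotential σ s a‖ ≤ ∫ x in (0:ℝ)..(2 * Real.pi), V ^ (2 * σ) / 2 *
      (η⁻¹ * ‖trigPoly s a x‖ ^ 2 + η * ‖trigPoly s (dCoeff a) x‖ ^ 2) := by
    refine intervalIntegral.norm_integral_le_of_norm_le (by positivity) ?_
      (Continuous.intervalIntegrable (by fun_prop) _ _)
    refine Eventually.of_forall fun x _ => ?_
    set p := ‖trigPoly s a x‖ with hp
    set q := ‖trigPoly s (dCoeff a) x‖ with hq
    have hp0 : 0 ≤ p := norm_nonneg _
    have e1 : p ^ (2 * σ) ≤ V ^ (2 * σ) :=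
      Real.rpow_le_rpow hp0 ((norm_trigPoly_le s a x).trans hV) (by linarith)
    have e2 : |(conj (trigPoly s a x) * trigPoly s (dCoeff a) x).im| ≤ p * q := by
      refine (Complex.abs_im_le_norm _).trans_eq ?_
      rw [norm_mul, Complex.norm_conj]
    have e3 : p * q ≤ (η⁻¹ * p ^ 2 + η * q ^ 2) / 2 := by
      have : η⁻¹ * p ^ 2 + η * q ^ 2 - 2 * (p * q) = η⁻¹ * (p - η * q) ^ 2 := by
        field_simp; ring
      have : 0 ≤ η⁻¹ * (p - η * q) ^ 2 := by positivity
      linarith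
    rw [Real.norm_eq_abs, abs_mul, abs_of_nonneg (Real.rpow_nonneg hp0 _)]
    calc _ ≤ V ^ (2 * σ) * ((η⁻¹ * p ^ 2 + η * q ^ 2) / 2) :=
          mul_le_mul e1 (e2.trans e3) (abs_nonneg _) (Real.rpow_nonneg hV0 _)
      _ = _ := by ring
  rw [intervalIntegral.integral_const_mul, intervalIntegral.integral_add
    (Continuous.intervalIntegrable (by fun_prop) _ _)
    (Continuous.intervalIntegrable (by fun_prop) _ _), intervalIntegral.integral_const_mul,
    intervalIntegral.integral_const_mul, integral_norm_sq_trigPoly,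
    integral_norm_sq_trigPoly_dCoeff] at h
  refine h.trans_eq ?_
  ring

lemma norm_fc_trigNL_le {σ : ℝ} (hσ : 1 ≤ σ) {s : Finset ℤ} {a : ℤ → ℂ} {V : ℝ}
    (hV : ∑ k ∈ s, ‖a k‖ ≤ V) (k : ℤ) :
    ‖fc (trigNL σ s a) k‖ ≤ V ^ (2 * σ) * (1 + ∑ k ∈ s, (k : ℝ) ^ 2 * ‖a k‖ ^ 2) := by
  have hpi := Real.pi_pos
  have hV0 : 0 ≤ V := (Finset.sum_nonneg fun _ _ => norm_nonneg _).trans hV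
  have k2 := continuous_trigPoly s (dCoeff a)
  have h := norm_fc_le (F := trigNL σ s a)
    (g := fun x => V ^ (2 * σ) * (1 + ‖trigPoly s (dCoeff a) x‖ ^ 2)) (fun x => ?_)
    (by fun_prop) k
  · rw [intervalIntegral.integral_const_mul, intervalIntegral.integral_add
      (Continuous.intervalIntegrable (by fun_prop) _ _)
      (Continuous.intervalIntegrable (by fun_prop) _ _), integral_norm_sq_trigPoly_dCoeff,
      intervalIntegral.integral_const] at h
    refine h.trans_eq ?_
    simp only [smul_eq_mul]
    field_simp
    ring
  · rw [trigNL, norm_mul, Complex.norm_real, Real.norm_of_nonneg (by positivity)]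
    refine mul_le_mul (Real.rpow_le_rpow (norm_nonneg _) ((norm_trigPoly_le s a x).trans hV)
      (by linarith)) ?_ (norm_nonneg _) (Real.rpow_nonneg hV0 _)
    nlinarith [sq_nonneg (‖trigPoly s (dCoeff a) x‖ - 1), norm_nonneg (trigPoly s (dCoeff a) x)]

/-- Continuous induction for a bound that improves itself. -/
lemma lt_of_bootstrap {X : ℝ → ℝ} {T K : ℝ} (hX : ContinuousOn X (Icc 0 T)) (h0 : X 0 < K)
    (h : ∀ t ∈ Icc 0 T, (∀ τ ∈ Icc 0 t, X τ ≤ K) → X t < K) :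
    ∀ t ∈ Icc 0 T, X t < K := by
  by_contra! hcon
  have hclosed : IsCompact (Icc 0 T ∩ X ⁻¹' Ici K) :=
    isCompact_Icc.of_isClosed_subset (hX.preimage_isClosed_of_isClosed isClosed_Icc isClosed_Ici)
      inter_subset_left
  obtain ⟨t, ht, hmin⟩ := hclosed.exists_isLeast (by
    obtain ⟨t, ht, htK⟩ := hcon
    exact ⟨t, ht, htK⟩)
  have hlt : ∀ τ ∈ Icc 0 T, τ < t → X τ < K := fun τ hτ hlt => by
    by_contra! hK
    exact absurd (hmin ⟨hτ, hK⟩) (not_le.2 hlt)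
  have hsub : Icc 0 t ⊆ Icc 0 T := Icc_subset_Icc_right ht.1.2
  obtain ⟨τ, hτ, hτK⟩ := intermediate_value_Icc ht.1.1 (hX.mono hsub) ⟨h0.le, ht.2⟩
  have hτt : τ = t := by
    by_contra hne
    exact absurd hτK (hlt τ (hsub hτ) (lt_of_le_of_ne hτ.2 hne)).ne
  refine absurd (h t ht.1 fun τ' hτ' => ?_) (not_lt.2 ht.2)
  rcases hτ'.2.eq_or_lt with e | e
  · rw [e, ← hτt, hτK]
  · exact (hlt τ' (hsub hτ') e).le

lemma summable_inv_one_add_sq : Summable fun k : ℤ => (1 + (k : ℝ) ^ 2)⁻¹ := by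
  have h := (Real.summable_one_div_int_pow (p := 2)).2 (by norm_num)
  refine Summable.of_norm_bounded_eventually h ?_
  have : ({0} : Set ℤ)ᶜ ∈ cofinite := (Set.finite_singleton (0 : ℤ)).compl_mem_cofinite
  filter_upwards [this] with k hk
  have hk' : (0 : ℝ) < (k : ℝ) ^ 2 := by
    have : (k : ℝ) ≠ 0 := by exact_mod_cast hk
    positivity
  rw [Real.norm_of_nonneg (by positivity), one_div]
  exact inv_anti₀ hk' (by linarith)

/-- The energy estimate, uniform in the frequency set: as long as the sup norm is controlled by
`V`, conservation of mass and energy bound the `H¹` norm. -/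
lemma sum_sq_le_of_energy_eq {σ : ℝ} (hσ : 1 ≤ σ) {s : Finset ℤ} {a b : ℤ → ℂ} {V H : ℝ}
    (hV : 0 < V) (haV : ∑ k ∈ s, ‖a k‖ ≤ V) (hbV : ∑ k ∈ s, ‖b k‖ ≤ V)
    (hH : ∑ k ∈ s, (1 + (k : ℝ) ^ 2) * ‖a k‖ ^ 2 ≤ H)
    (hM : ∑ k ∈ s, ‖b k‖ ^ 2 = ∑ k ∈ s, ‖a k‖ ^ 2)
    (hE : ∑ k ∈ s, (k : ℝ) ^ 2 * ‖b k‖ ^ 2 + ((2 * σ + 2) * Real.pi)⁻¹ * trigPotential σ s b =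
      ∑ k ∈ s, (k : ℝ) ^ 2 * ‖a k‖ ^ 2 + ((2 * σ + 2) * Real.pi)⁻¹ * trigPotential σ s a) :
    ∑ k ∈ s, (1 + (k : ℝ) ^ 2) * ‖b k‖ ^ 2 ≤ (4 + 2 * (V ^ (2 * σ) / (σ + 1)) ^ 2) * H := by
  have hpi := Real.pi_pos
  have hσ1 : 0 < σ + 1 := by linarith
  have hP : 0 < V ^ (2 * σ) := Real.rpow_pos_of_pos hV _
  have hη : 0 < (σ + 1) / V ^ (2 * σ) := by positivity
  have qa := abs_trigPotential_le hσ haV hη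
  have qb := abs_trigPotential_le hσ hbV hη
  simp only [add_mul, one_mul, Finset.sum_add_distrib] at hH ⊢
  rw [hM] at qb ⊢
  set M := ∑ k ∈ s, ‖a k‖ ^ 2
  set S := ∑ k ∈ s, (k : ℝ) ^ 2 * ‖a k‖ ^ 2
  set S' := ∑ k ∈ s, (k : ℝ) ^ 2 * ‖b k‖ ^ 2
  have hM0 : 0 ≤ M := Finset.sum_nonneg fun _ _ => sq_nonneg _
  have hS0 : 0 ≤ S := Finset.sum_nonneg fun _ _ => by positivity
  set P := V ^ (2 * σ)
  have hc : 0 < ((2 * σ + 2) * Real.pi)⁻¹ := by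
    have : 0 < 2 * σ + 2 := by linarith
    positivity
  have e : ∀ S₁ : ℝ, ((2 * σ + 2) * Real.pi)⁻¹ *
      (P * Real.pi * (((σ + 1) / P)⁻¹ * M + (σ + 1) / P * S₁)) =
      (P / (σ + 1)) ^ 2 / 2 * M + S₁ / 2 := fun S₁ => by
    have : 2 * σ + 2 = 2 * (σ + 1) := by ring
    rw [this]
    field_simp
  have ra := mul_le_mul_of_nonneg_left ((le_abs_self _).trans qa) hc.le
  have rb := mul_le_mul_of_nonneg_left ((neg_le_abs _).trans qb) hc.le
  rw [e] at ra rb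
  set D := (P / (σ + 1)) ^ 2
  have hD : 0 ≤ D := sq_nonneg _
  have key : S' ≤ 3 * S + 2 * D * M := by linarith
  nlinarith [mul_nonneg hD hS0, mul_nonneg hD hM0, mul_le_mul_of_nonneg_left hH hD]

/-- The uniform `H¹` bound for the mollified flow, on a time interval depending only on the
size of the data in `H¹`. -/
lemma exists_uniform_bound {σ : ℝ} (hσ : 1 ≤ σ) {H : ℝ} (hH : 0 ≤ H) :
    ∃ T > (0:ℝ), ∃ K > (0:ℝ), ∀ (s : Finset ℤ) (a : ℝ → ℤ → ℂ) (U : Set ℝ), IsOpen U →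
      Icc 0 T ⊆ U →
      (∀ t ∈ U, ∀ k ∈ s, HasDerivAt (fun τ => a τ k) (coeffField σ s (a t) k) t) →
      (∀ k ∈ s, ContinuousOn (fun τ => coeffField σ s (a τ) k) U) →
      ∑ k ∈ s, (1 + (k : ℝ) ^ 2) * ‖a 0 k‖ ^ 2 ≤ H →
      ∀ t ∈ Icc 0 T, ∑ k ∈ s, (1 + (k : ℝ) ^ 2) * ‖a t k‖ ^ 2 ≤ K := by
  set κ := ∑' k : ℤ, (1 + (k : ℝ) ^ 2)⁻¹ with hκ
  have hw : ∀ k : ℤ, 0 < 1 + (k : ℝ) ^ 2 := fun k => by positivity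
  have hκs : ∀ s : Finset ℤ, ∑ k ∈ s, (1 + (k : ℝ) ^ 2)⁻¹ ≤ κ := fun s =>
    summable_inv_one_add_sq.sum_le_tsum s fun k _ => (inv_pos.2 (hw k)).le
  have hsup : ∀ (s : Finset ℤ) (a : ℤ → ℂ) (L : ℝ),
      ∑ k ∈ s, (1 + (k : ℝ) ^ 2) * ‖a k‖ ^ 2 ≤ L → ∑ k ∈ s, ‖a k‖ ≤ √κ * √L := fun s a L hL =>
    (sum_norm_le_sqrt s a _ hw).trans
      (mul_le_mul (Real.sqrt_le_sqrt (hκs s)) (Real.sqrt_le_sqrt hL) (Real.sqrt_nonneg _)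
        (Real.sqrt_nonneg _))
  set V := √κ * √H + 1 with hVdef
  have hV : 0 < V := by positivity
  set K := (4 + 2 * (V ^ (2 * σ) / (σ + 1)) ^ 2) * H + 1 with hKdef
  have hK : 0 < K := by positivity
  obtain ⟨s₀, hs₀⟩ := summable_iff_vanishing_norm.1 summable_inv_one_add_sq (1 / (16 * K))
    (by positivity)
  set B := (√κ * √K) ^ (2 * σ) * (1 + K) with hB
  have hB0 : 0 ≤ B := by positivity
  set C := ∑ k ∈ s₀, (B + (k : ℝ) ^ 2 * √K) with hC
  have hC0 : 0 ≤ C := Finset.sum_nonneg fun k _ => by positivity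
  refine ⟨1 / (2 * (C + 1)), by positivity, K, hK, fun s a U hU hTU ha hb h0 t ht => ?_⟩
  refine (lt_of_bootstrap (X := fun τ => ∑ k ∈ s, (1 + (k : ℝ) ^ 2) * ‖a τ k‖ ^ 2) ?_ ?_
    (fun t ht hbd => ?_) t ht).le
  · refine continuousOn_finsetSum _ fun k hk => continuousOn_const.mul (ContinuousOn.pow ?_ 2)
    exact ContinuousOn.norm fun τ hτ => (ha τ (hTU hτ) k hk).continuousAt.continuousWithinAt
  · refine h0.trans_lt ?_
    have : 0 ≤ (3 + 2 * (V ^ (2 * σ) / (σ + 1)) ^ 2) * H := by positivity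
    rw [hKdef]; linarith
  · have hmass : ∑ k ∈ s, ‖a t k‖ ^ 2 = ∑ k ∈ s, ‖a 0 k‖ ^ 2 :=
      eq_of_hasDerivAt_zero (f := fun τ => ∑ k ∈ s, ‖a τ k‖ ^ 2)
        (fun τ hτ => hasDerivAt_mass hσ (r := 1) fun k hk => by
          simpa using ha τ (hTU hτ) k hk) t ht
    have henergy := eq_of_hasDerivAt_zero
      (fun τ hτ => hasDerivAt_energy hσ hU ha hb (hTU hτ)) t ht
    have hlow : ∀ k ∈ s, ‖a t k - a 0 k‖ ≤ (B + (k : ℝ) ^ 2 * √K) * t := by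
      intro k hk
      have := norm_image_sub_le_of_norm_deriv_le_segment' (f := fun τ => a τ k)
        (f' := fun τ => coeffField σ s (a τ) k) (a := 0) (b := t) (C := B + (k : ℝ) ^ 2 * √K)
        (fun τ hτ => (ha τ (hTU ⟨hτ.1, hτ.2.trans ht.2⟩) k hk).hasDerivWithinAt)
        (fun τ hτ => ?_) t ⟨ht.1, le_rfl⟩
      · simpa using this
      · have hτK := hbd τ (Ico_subset_Icc_self hτ)
        have hS : ∑ k ∈ s, (k : ℝ) ^ 2 * ‖a τ k‖ ^ 2 ≤ K :=
          (Finset.sum_le_sum fun k _ => by nlinarith [sq_nonneg ‖a τ k‖]).trans hτK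
        have hk1 : ‖a τ k‖ ≤ √K := by
          refine Real.le_sqrt_of_sq_le (le_trans ?_ ((Finset.single_le_sum
            (f := fun k : ℤ => (1 + (k : ℝ) ^ 2) * ‖a τ k‖ ^ 2)
            (fun k _ => by positivity) hk).trans hτK))
          nlinarith [mul_nonneg (sq_nonneg (k : ℝ)) (sq_nonneg ‖a τ k‖)]
        have hfc := norm_fc_trigNL_le hσ (hsup s (a τ) K hτK) k
        refine (norm_sub_le _ _).trans (add_le_add ?_ ?_)
        · rw [norm_neg]
          exact hfc.trans (mul_le_mul_of_nonneg_left (by linarith) (by positivity))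
        · rw [norm_mul, norm_mul, Complex.norm_I, one_mul, norm_pow, Complex.norm_intCast,
            sq_abs]
          gcongr
    have hdiff : ∑ k ∈ s, ‖a t k - a 0 k‖ ≤ 1 := by
      classical
      rw [← Finset.sum_inter_add_sum_sdiff s s₀]
      have h1 : ∑ k ∈ s ∩ s₀, ‖a t k - a 0 k‖ ≤ 1 / 2 := by
        calc ∑ k ∈ s ∩ s₀, ‖a t k - a 0 k‖
            ≤ ∑ k ∈ s ∩ s₀, (B + (k : ℝ) ^ 2 * √K) * t :=
              Finset.sum_le_sum fun k hk => hlow k (Finset.mem_inter.1 hk).1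
          _ ≤ ∑ k ∈ s₀, (B + (k : ℝ) ^ 2 * √K) * t :=
              Finset.sum_le_sum_of_subset_of_nonneg Finset.inter_subset_right
                fun k _ _ => mul_nonneg (by positivity) ht.1
          _ = C * t := by rw [← Finset.sum_mul]
          _ ≤ C * (1 / (2 * (C + 1))) := mul_le_mul_of_nonneg_left ht.2 hC0
          _ ≤ 1 / 2 := by
              rw [mul_one_div, div_le_div_iff₀ (by positivity) (by positivity)]; linarith
      have h2 : ∑ k ∈ s \ s₀, ‖a t k - a 0 k‖ ≤ 1 / 2 := by
        refine (sum_norm_le_sqrt (s \ s₀) (fun k => a t k - a 0 k) _ hw).trans ?_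
        have e1 : ∑ k ∈ s \ s₀, (1 + (k : ℝ) ^ 2)⁻¹ ≤ 1 / (16 * K) :=
          (le_abs_self _).trans (hs₀ _ Finset.sdiff_disjoint).le
        have e2 : ∑ k ∈ s \ s₀, (1 + (k : ℝ) ^ 2) * ‖a t k - a 0 k‖ ^ 2 ≤ 4 * K := by
          calc ∑ k ∈ s \ s₀, (1 + (k : ℝ) ^ 2) * ‖a t k - a 0 k‖ ^ 2
              ≤ ∑ k ∈ s, (1 + (k : ℝ) ^ 2) * ‖a t k - a 0 k‖ ^ 2 :=
                Finset.sum_le_sum_of_subset_of_nonneg Finset.sdiff_subset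
                  fun k _ _ => by positivity
            _ ≤ ∑ k ∈ s, (2 * ((1 + (k : ℝ) ^ 2) * ‖a t k‖ ^ 2) +
                  2 * ((1 + (k : ℝ) ^ 2) * ‖a 0 k‖ ^ 2)) := by
                refine Finset.sum_le_sum fun k _ => ?_
                have h3 : ‖a t k - a 0 k‖ ^ 2 ≤ 2 * ‖a t k‖ ^ 2 + 2 * ‖a 0 k‖ ^ 2 := by
                  have := norm_sub_le (a t k) (a 0 k)
                  nlinarith [sq_nonneg (‖a t k‖ - ‖a 0 k‖), norm_nonneg (a t k - a 0 k)]
                nlinarith [mul_le_mul_of_nonneg_left h3 (hw k).le]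
            _ ≤ 4 * K := by
                rw [Finset.sum_add_distrib, ← Finset.mul_sum, ← Finset.mul_sum]
                linarith [hbd t ⟨ht.1, le_rfl⟩, hbd 0 ⟨le_rfl, ht.1⟩]
        calc _ ≤ √(1 / (16 * K)) * √(4 * K) := by gcongr
          _ = √((1 / 2) ^ 2) := by
            rw [← Real.sqrt_mul (by positivity)]; congr 1; field_simp; norm_num
          _ = 1 / 2 := Real.sqrt_sq (by norm_num)
      linarith
    have hini := hsup s (a 0) H h0
    have htV : ∑ k ∈ s, ‖a t k‖ ≤ V := by
      calc ∑ k ∈ s, ‖a t k‖ ≤ ∑ k ∈ s, (‖a 0 k‖ + ‖a t k - a 0 k‖) :=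
            Finset.sum_le_sum fun k _ => by
              simpa using norm_add_le (a 0 k) (a t k - a 0 k)
        _ ≤ V := by rw [Finset.sum_add_distrib]; linarith
    have := sum_sq_le_of_energy_eq hσ hV (by linarith) htV h0 hmass henergy
    linarith

/-- A vector field that is Lipschitz on bounded sets has a global flow line after multiplication
by a cutoff that equals `1` on a given ball. -/
lemma exists_cutoff_flow {E : Type*} [NormedAddCommGroup E] [NormedSpace ℝ E]
    [FiniteDimensional ℝ E] {G : E → E}
    (hG : ∀ R : ℝ, ∃ K : ℝ≥0, LipschitzOnWith K G (closedBall 0 R)) (x₀ : E) {R T : ℝ}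
    (hR : 0 < R) (hT : 0 ≤ T) :
    ∃ (χ : E → ℝ) (α : ℝ → E), (∀ x, ‖x‖ ≤ R → χ x = 1) ∧ α 0 = x₀ ∧
      ∀ t ∈ Ioo (-T) T, HasDerivAt α (χ (α t) • G (α t)) t := by
  let χ : ContDiffBump (0 : E) := ⟨R, R + 1, hR, by linarith⟩
  have hGc : Continuous G := by
    rw [continuous_iff_continuousAt]
    intro x
    obtain ⟨K, hK⟩ := hG (‖x‖ + 1)
    exact hK.continuousOn.continuousAt
      (closedBall_mem_nhds_of_mem (by simp))
  have hcont : Continuous fun x => χ x • G x := χ.continuous.smul hGc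
  have hsupp : HasCompactSupport fun x => χ x • G x := χ.hasCompactSupport.smul_right
  obtain ⟨L, hL⟩ := hsupp.exists_bound_of_continuous hcont
  have hL0 : 0 ≤ L := (norm_nonneg _).trans (hL 0)
  obtain ⟨Kχ, hKχ⟩ := (χ.contDiff (n := 1)).lipschitzWith_of_hasCompactSupport
    χ.hasCompactSupport one_ne_zero
  have hLT : 0 ≤ L * T := mul_nonneg hL0 hT
  obtain ⟨KG, hKG⟩ := hG (‖x₀‖ + L * T)
  have hsub : closedBall x₀ (L * T) ⊆ closedBall 0 (‖x₀‖ + L * T) :=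
    closedBall_subset_closedBall' (by rw [dist_zero_right]; linarith)
  obtain ⟨C, hC⟩ := (isCompact_closedBall x₀ (L * T)).exists_bound_of_continuousOn
    hGc.continuousOn
  have hC0 : 0 ≤ C := (norm_nonneg _).trans (hC x₀ (mem_closedBall_self hLT))
  have hlip : LipschitzOnWith (KG + Kχ * C.toNNReal) (fun x => χ x • G x)
      (closedBall x₀ (L * T)) := by
    refine LipschitzOnWith.of_dist_le_mul fun x hx y hy => ?_
    have h1 := hKG.dist_le_mul x (hsub hx) y (hsub hy)
    have h2 := hKχ.dist_le_mul x y
    rw [dist_eq_norm] at h1 h2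
    rw [dist_eq_norm (χ x • G x)]
    have e : χ x • G x - χ y • G y = χ x • (G x - G y) + (χ x - χ y) • G y := by
      rw [smul_sub, sub_smul]; abel
    rw [e]
    refine (norm_add_le _ _).trans ?_
    rw [norm_smul, norm_smul, Real.norm_of_nonneg χ.nonneg]
    push_cast
    rw [Real.coe_toNNReal C hC0, add_mul]
    refine add_le_add ?_ ?_
    · calc χ x * ‖G x - G y‖ ≤ 1 * ‖G x - G y‖ :=
            mul_le_mul_of_nonneg_right χ.le_one (norm_nonneg _)
        _ ≤ _ := by rw [one_mul]; exact h1
    · calc ‖χ x - χ y‖ * ‖G y‖ ≤ (Kχ * dist x y) * C :=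
            mul_le_mul h2 (hC y hy) (norm_nonneg _) (by positivity)
        _ = _ := by ring
  have hPL : IsPicardLindelof (fun _ x => χ x • G x) (tmin := -T) (tmax := T)
      ⟨0, by simpa using hT, hT⟩ x₀ ⟨L * T, hLT⟩ 0 ⟨L, hL0⟩ (KG + Kχ * C.toNNReal) :=
    IsPicardLindelof.of_time_independent (fun x _ => hL x) hlip (by simp; exact le_rfl)
  obtain ⟨α, hα0, hα⟩ := hPL.exists_eq_forall_mem_Icc_hasDerivWithinAt₀
  exact ⟨χ, α, fun x hx => χ.one_of_mem_closedBall (by simpa using hx), hα0,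
    fun t ht => (hα t (Ioo_subset_Icc_self ht)).hasDerivAt (Icc_mem_nhds ht.1 ht.2)⟩

/-- Extension by zero of coefficients indexed by `s`. -/
def extCoeff (s : Finset ℤ) (a : s → ℂ) (k : ℤ) : ℂ := if h : k ∈ s then a ⟨k, h⟩ else 0

lemma contDiff_extCoeff (s : Finset ℤ) (k : ℤ) :
    ContDiff ℝ 1 fun a : s → ℂ => extCoeff s a k := by
  unfold extCoeff
  split_ifs
  · fun_prop
  · fun_prop

lemma contDiff_exp_int_mul (c : ℂ) : ContDiff ℝ 1 fun x : ℝ => Complex.exp (c * (x : ℂ)) :=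
  (contDiff_const.mul Complex.ofRealCLM.contDiff).cexp

lemma contDiff_trigPoly {E : Type*} [NormedAddCommGroup E] [NormedSpace ℝ E] {s : Finset ℤ}
    {a : E → ℤ → ℂ} (ha : ∀ k ∈ s, ContDiff ℝ 1 fun p => a p k) :
    ContDiff ℝ 1 fun p : E × ℝ => trigPoly s (a p.1) p.2 := by
  unfold trigPoly
  exact ContDiff.sum fun k hk => ((ha k hk).comp contDiff_fst).mul
    ((contDiff_exp_int_mul _).comp contDiff_snd)

/-- An integral depending on a parameter is Lipschitz on balls if the integrand is `C¹`. -/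
lemma exists_lipschitzOnWith_intervalIntegral {E : Type*} [NormedAddCommGroup E] [NormedSpace ℝ E]
    [FiniteDimensional ℝ E] {f : E × ℝ → ℂ} (hf : ContDiff ℝ 1 f) {c d : ℝ} (hcd : c ≤ d)
    (R : ℝ) :
    ∃ K : ℝ≥0, LipschitzOnWith K (fun a => ∫ x in c..d, f (a, x)) (closedBall 0 R) := by
  obtain ⟨K, hK⟩ := hf.contDiffOn.exists_lipschitzOnWith (s := closedBall 0 R ×ˢ Icc c d)
    one_ne_zero ((convex_closedBall 0 R).prod (convex_Icc c d))
    ((isCompact_closedBall 0 R).prod isCompact_Icc)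
  refine ⟨K * (d - c).toNNReal, LipschitzOnWith.of_dist_le_mul fun a ha b hb => ?_⟩
  have hcont : ∀ a, Continuous fun x : ℝ => f (a, x) := fun a =>
    hf.continuous.comp (by fun_prop)
  rw [dist_eq_norm, ← intervalIntegral.integral_sub ((hcont a).intervalIntegrable _ _)
    ((hcont b).intervalIntegrable _ _)]
  refine (intervalIntegral.norm_integral_le_of_norm_le_const (C := K * dist a b)
    fun x hx => ?_).trans_eq ?_
  · have hx' : x ∈ Icc c d := by
      rw [uIoc_of_le hcd] at hx; exact Ioc_subset_Icc_self hx
    have := hK.dist_le_mul (a, x) ⟨ha, hx'⟩ (b, x) ⟨hb, hx'⟩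
    rw [dist_eq_norm, Prod.dist_eq, dist_self, max_eq_left dist_nonneg] at this
    exact this
  · rw [NNReal.coe_mul, Real.coe_toNNReal _ (sub_nonneg.2 hcd), abs_of_nonneg (sub_nonneg.2 hcd)]
    ring

lemma contDiff_trigNL {σ : ℝ} (hσ : 1 ≤ σ) (s : Finset ℤ) :
    ContDiff ℝ 1 fun p : (s → ℂ) × ℝ => trigNL σ s (extCoeff s p.1) p.2 := by
  unfold trigNL
  have h1 : ContDiff ℝ 1 fun p : (s → ℂ) × ℝ => trigPoly s (extCoeff s p.1) p.2 :=
    contDiff_trigPoly fun k _ => contDiff_extCoeff s k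
  have h2 : ContDiff ℝ 1 fun p : (s → ℂ) × ℝ => trigPoly s (dCoeff (extCoeff s p.1)) p.2 :=
    contDiff_trigPoly (a := fun p : s → ℂ => dCoeff (extCoeff s p)) fun k _ =>
      contDiff_const.mul (contDiff_extCoeff s k)
  exact (Complex.ofRealCLM.contDiff.comp (h1.norm_rpow (by linarith))).mul h2

lemma exists_lipschitzOnWith_coeffField {σ : ℝ} (hσ : 1 ≤ σ) (s : Finset ℤ) (R : ℝ) :
    ∃ K : ℝ≥0, LipschitzOnWith K (fun (a : s → ℂ) (k : s) => coeffField σ s (extCoeff s a) k)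
      (closedBall 0 R) := by
  have hcomp : ∀ k : s, ∃ K : ℝ≥0, LipschitzOnWith K
      (fun a : s → ℂ => coeffField σ s (extCoeff s a) k) (closedBall 0 R) := by
    intro k
    have hpi := Real.pi_pos
    obtain ⟨K₁, hK₁⟩ := exists_lipschitzOnWith_intervalIntegral
      (f := fun p : (s → ℂ) × ℝ => (1 / (2 * Real.pi) : ℂ) * (trigNL σ s (extCoeff s p.1) p.2 *
        Complex.exp (-(Complex.I) * ((k : ℤ) : ℂ) * (p.2 : ℂ))))
      (contDiff_const.mul ((contDiff_trigNL hσ s).mul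
        ((contDiff_exp_int_mul _).comp contDiff_snd)))
      (c := 0) (d := 2 * Real.pi) (by positivity) R
    obtain ⟨K₂, hK₂⟩ := (ContDiff.contDiffOn (s := closedBall (0 : s → ℂ) R)
      ((contDiff_const (c := Complex.I * ((k : ℤ) : ℂ) ^ 2)).mul
        (contDiff_extCoeff s k))).exists_lipschitzOnWith
      one_ne_zero (convex_closedBall 0 R) (isCompact_closedBall 0 R)
    refine ⟨K₁ + K₂, ?_⟩
    have h := hK₁.neg.sub hK₂
    simp only [intervalIntegral.integral_const_mul] at h
    exact h
  choose K hK using hcomp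
  refine ⟨∑ k, K k, LipschitzOnWith.of_dist_le_mul fun a ha b hb => ?_⟩
  refine (dist_pi_le_iff (by positivity)).2 fun k => ((hK k).dist_le_mul a ha b hb).trans ?_
  refine mul_le_mul_of_nonneg_right ?_ dist_nonneg
  exact_mod_cast Finset.single_le_sum (f := K) (fun _ _ => zero_le) (Finset.mem_univ k)

lemma extCoeff_coe (s : Finset ℤ) (a : s → ℂ) (k : s) : extCoeff s a k = a k := by
  simp [extCoeff]

/-- Global existence for the coefficient system: conservation of mass confines the cutoff flow
to the region where the cutoff is trivial. -/
lemma exists_coeff_flow {σ : ℝ} (hσ : 1 ≤ σ) (s : Finset ℤ) (c : ℤ → ℂ) {T : ℝ} (hT : 0 < T) :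
    ∃ (a : ℝ → ℤ → ℂ) (U : Set ℝ), IsOpen U ∧ Icc 0 T ⊆ U ∧ (∀ k ∈ s, a 0 k = c k) ∧
      (∀ t ∈ U, ∀ k ∈ s, HasDerivAt (fun τ => a τ k) (coeffField σ s (a t) k) t) ∧
      (∀ k ∈ s, ContinuousOn (fun τ => coeffField σ s (a τ) k) U) := by
  set G : (s → ℂ) → s → ℂ := fun a k => coeffField σ s (extCoeff s a) k with hGdef
  have hG : ∀ R : ℝ, ∃ K : ℝ≥0, LipschitzOnWith K G (closedBall 0 R) :=
    exists_lipschitzOnWith_coeffField hσ s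
  have hGc : Continuous G := by
    rw [continuous_iff_continuousAt]
    intro x
    obtain ⟨K, hK⟩ := hG (‖x‖ + 1)
    exact hK.continuousOn.continuousAt (closedBall_mem_nhds_of_mem (by simp))
  set M := ∑ k ∈ s, ‖c k‖ ^ 2 with hM
  obtain ⟨χ, α, hχ, hα0, hα⟩ := exists_cutoff_flow hG (fun k : s => c k) (R := √M + 1)
    (T := T + 1) (by positivity) (by linarith)
  have hderiv : ∀ t ∈ Ioo (-(T + 1)) (T + 1), ∀ k ∈ s, HasDerivAt (fun τ => extCoeff s (α τ) k)
      ((χ (α t) : ℂ) * coeffField σ s (extCoeff s (α t)) k) t := by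
    intro t ht k hk
    have := (hasDerivAt_pi.1 (hα t ht)) ⟨k, hk⟩
    simpa [extCoeff, hk, hGdef] using this
  have hmass : ∀ t ∈ Ioo (-(T + 1)) (T + 1), ∑ k ∈ s, ‖extCoeff s (α t) k‖ ^ 2 = M := by
    intro t ht
    have h0 : (0 : ℝ) ∈ Ioo (-(T + 1)) (T + 1) := ⟨by linarith, by linarith⟩
    have hd : ∀ τ ∈ Ioo (-(T + 1)) (T + 1),
        HasDerivAt (fun τ => ∑ k ∈ s, ‖extCoeff s (α τ) k‖ ^ 2) 0 τ := fun τ hτ =>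
      hasDerivAt_mass hσ (a := fun τ => extCoeff s (α τ)) (hderiv τ hτ)
    have := isOpen_Ioo.is_const_of_deriv_eq_zero isPreconnected_Ioo
      (fun τ hτ => (hd τ hτ).differentiableAt.differentiableWithinAt)
      (fun τ hτ => (hd τ hτ).deriv) ht h0
    rw [this, hM]
    refine Finset.sum_congr rfl fun k hk => ?_
    simp [hα0, extCoeff, hk]
  have hone : ∀ t ∈ Ioo (-(T + 1)) (T + 1), χ (α t) = 1 := by
    intro t ht
    refine hχ _ ((pi_norm_le_iff_of_nonneg (by positivity)).2 fun k => ?_)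
    have h1 : ‖α t k‖ ^ 2 ≤ M := by
      rw [← hmass t ht, ← extCoeff_coe s (α t) k]
      exact Finset.single_le_sum (f := fun k : ℤ => ‖extCoeff s (α t) k‖ ^ 2)
        (fun k _ => sq_nonneg _) k.2
    linarith [Real.le_sqrt_of_sq_le h1]
  refine ⟨fun t => extCoeff s (α t), Ioo (-(T + 1)) (T + 1), isOpen_Ioo,
    fun t ht => ⟨by linarith [ht.1], by linarith [ht.2]⟩, fun k hk => ?_, fun t ht k hk => ?_,
    fun k hk => ?_⟩
  · simp [hα0, extCoeff, hk]
  · have := hderiv t ht k hk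
    rwa [hone t ht, Complex.ofReal_one, one_mul] at this
  · have h1 : ContinuousOn α (Ioo (-(T + 1)) (T + 1)) := fun t ht =>
      (hα t ht).continuousAt.continuousWithinAt
    exact ((continuous_apply (⟨k, hk⟩ : s)).comp hGc).comp_continuousOn h1

lemma trigPoly_congr {s : Finset ℤ} {a b : ℤ → ℂ} (h : ∀ k ∈ s, a k = b k) :
    trigPoly s a = trigPoly s b :=
  funext fun _ => Finset.sum_congr rfl fun k hk => by rw [h k hk]

lemma abs_int_rpow_two (k : ℤ) : |(k : ℝ)| ^ ((2 : ℝ) * 1) = (k : ℝ) ^ 2 := by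
  rw [mul_one, Real.rpow_two, sq_abs]

/-- `f` with its Fourier coefficients on `s` replaced by `a`. -/
def replaceCoeff (s : Finset ℤ) (f : ℝ → ℂ) (a : ℤ → ℂ) (x : ℝ) : ℂ :=
  f x + (trigPoly s a x - trigPoly s (fc f) x)

lemma fc_replaceCoeff (s : Finset ℤ) {f : ℝ → ℂ}
    (hf : IntervalIntegrable f volume 0 (2 * Real.pi)) (a : ℤ → ℂ) (k : ℤ) :
    fc (replaceCoeff s f a) k = if k ∈ s then a k else fc f k := by
  have h1 := (continuous_trigPoly s a).intervalIntegrable (μ := volume) 0 (2 * Real.pi)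
  have h2 := (continuous_trigPoly s (fc f)).intervalIntegrable (μ := volume) 0 (2 * Real.pi)
  have h : replaceCoeff s f a = fun x => f x + (trigPoly s a x + -trigPoly s (fc f) x) := by
    funext x
    rw [replaceCoeff, sub_eq_add_neg]
  have h2' : IntervalIntegrable (fun x => -trigPoly s (fc f) x) volume 0 (2 * Real.pi) := h2.neg
  rw [h, fc_add hf (h1.add h2'), fc_add h1 h2', fc_neg, fc_trigPoly, fc_trigPoly]
  split_ifs <;> ring

lemma molRHS_replaceCoeff {σ : ℝ} (hσ : 1 ≤ σ) (ε : ℝ) {f : ℝ → ℂ}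
    (hf : IntervalIntegrable f volume 0 (2 * Real.pi)) (a : ℤ → ℂ) :
    MolRHS σ ε (replaceCoeff (Finset.Icc (-(Nmoll ε)) (Nmoll ε)) f a) =
      trigPoly (Finset.Icc (-(Nmoll ε)) (Nmoll ε))
        (coeffField σ (Finset.Icc (-(Nmoll ε)) (Nmoll ε)) a) := by
  set s := Finset.Icc (-(Nmoll ε)) (Nmoll ε) with hs
  have hJ : Jmol ε (replaceCoeff s f a) = trigPoly s a :=
    trigPoly_congr fun k hk => by rw [fc_replaceCoeff s hf, if_pos hk]
  have hF : Fmol σ ε (replaceCoeff s f a) = fun x =>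
      -trigNL σ s a x + Complex.I * trigPoly s (dCoeff (dCoeff a)) x := by
    funext x
    simp only [Fmol, MolNL, hJ, deriv_trigPoly]
    rfl
  refine trigPoly_congr fun k hk => ?_
  have h1 : IntervalIntegrable (fun x => -trigNL σ s a x) volume 0 (2 * Real.pi) :=
    (continuous_trigNL hσ s a).neg.intervalIntegrable _ _
  have h2 := ((continuous_trigPoly s (dCoeff (dCoeff a))).const_mul
    Complex.I).intervalIntegrable (μ := volume) 0 (2 * Real.pi)
  rw [hF, fc_add h1 h2, fc_neg, fc_const_mul, fc_trigPoly, if_pos hk, coeffField]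
  simp only [dCoeff]
  linear_combination (Complex.I * (k : ℂ) ^ 2 * a k) * Complex.I_sq

lemma memHs_replaceCoeff (s : Finset ℤ) {f : ℝ → ℂ} (hf : MemHs 1 f) {a : ℤ → ℂ} {K : ℝ}
    (ha : ∑ k ∈ s, (1 + (k : ℝ) ^ 2) * ‖a k‖ ^ 2 ≤ K) :
    MemHs 1 (replaceCoeff s f a) ∧
      HsNorm 1 (replaceCoeff s f a) ≤ Real.sqrt (K + HsNormSq 1 f) := by
  obtain ⟨hper, hint, hsum⟩ := hf
  set g : ℤ → ℝ := fun k => if k ∈ s then (1 + (k : ℝ) ^ 2) * ‖a k‖ ^ 2 else 0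
  have hg : HasSum g (∑ k ∈ s, (1 + (k : ℝ) ^ 2) * ‖a k‖ ^ 2) := by
    rw [← Finset.sum_congr rfl fun k hk => show g k = _ from if_pos hk]
    exact hasSum_sum_of_ne_finset_zero fun k hk => if_neg hk
  have hle : ∀ k : ℤ, (1 + |(k : ℝ)| ^ ((2 : ℝ) * 1)) * ‖fc (replaceCoeff s f a) k‖ ^ 2 ≤
      g k + (1 + |(k : ℝ)| ^ ((2 : ℝ) * 1)) * ‖fc f k‖ ^ 2 := by
    intro k
    simp only [g, fc_replaceCoeff s hint, abs_int_rpow_two]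
    split_ifs
    · exact le_add_of_nonneg_right (by positivity)
    · rw [zero_add]
  have hsum' : Summable fun k : ℤ =>
      (1 + |(k : ℝ)| ^ ((2 : ℝ) * 1)) * ‖fc (replaceCoeff s f a) k‖ ^ 2 :=
    Summable.of_nonneg_of_le (fun k => by positivity) hle (hg.summable.add hsum)
  refine ⟨⟨?_, ?_, hsum'⟩, Real.sqrt_le_sqrt ?_⟩
  · intro x
    simp only [replaceCoeff, hper x, periodic_trigPoly s _ x]
  · exact hint.add (((continuous_trigPoly s a).sub
      (continuous_trigPoly s (fc f))).intervalIntegrable _ _)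
  · calc HsNormSq 1 (replaceCoeff s f a) ≤ _ := hsum'.tsum_le_tsum hle (hg.summable.add hsum)
      _ = _ := hg.summable.tsum_add hsum
      _ ≤ K + HsNormSq 1 f := by
        rw [hg.tsum_eq]
        exact add_le_add_left ha _

end

/-- For `σ ≥ 1` and `u₀ ∈ H¹(𝕋)`, there exist `T > 0` and `K > 0`,
independent of `ε`, such that for every `ε > 0` the solution of the mollified gDNLS equation
with data `u₀` exists on `[0,T]` and satisfies `sup_{[0,T]} ‖u_ε(t)‖_{H¹} ≤ K`. -/
theorem statement7 (σ : ℝ) (hσ : 1 ≤ σ) (u₀ : ℝ → ℂ) (hu₀ : MemHs 1 u₀) :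
    ∃ T > (0:ℝ), ∃ K > (0:ℝ), ∀ ε > (0:ℝ), ∃ u : ℝ → ℝ → ℂ,
      u 0 = u₀ ∧ SolvesMollified σ ε (Set.Icc 0 T) u ∧
      ∀ t ∈ Set.Icc (0:ℝ) T, MemHs 1 (u t) ∧ HsNorm 1 (u t) ≤ K := by
  have hH : 0 ≤ HsNormSq 1 u₀ := tsum_nonneg fun k => by positivity
  obtain ⟨T, hT, K, hK, hbound⟩ := exists_uniform_bound hσ hH
  refine ⟨T, hT, Real.sqrt (K + HsNormSq 1 u₀), Real.sqrt_pos.2 (by positivity), fun ε _ => ?_⟩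
  set s := Finset.Icc (-(Nmoll ε)) (Nmoll ε)
  obtain ⟨a, U, hU, hTU, ha0, hder, hcont⟩ := exists_coeff_flow hσ s (fc u₀) hT
  have hdata : ∑ k ∈ s, (1 + (k : ℝ) ^ 2) * ‖a 0 k‖ ^ 2 ≤ HsNormSq 1 u₀ := by
    rw [Finset.sum_congr rfl fun k hk => by rw [ha0 k hk, ← abs_int_rpow_two]]
    exact hu₀.2.2.sum_le_tsum s fun k _ => by positivity
  refine ⟨fun t => replaceCoeff s u₀ (a t), ?_, fun t ht x => ?_, fun t ht => ?_⟩
  · funext x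
    simp only [replaceCoeff, trigPoly_congr ha0, sub_self, add_zero]
  · rw [molRHS_replaceCoeff hσ ε hu₀.2.1]
    exact ((HasDerivAt.trigPoly (hder t (hTU ht)) x).sub_const _).const_add _
  · exact memHs_replaceCoeff s hu₀ (hbound s a U hU hTU hder hcont hdata t ht)
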